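/- arXiv:math/0401358 — 2 statements merged into one kernel-verified Lean document; each statement's English description precedes it below -/
import Mathlib

section
/- For every real number p > 1, the unique τ_p ∈ [0, 1] satisfying 2(1 − τ_p)^p = 1 + τ_p^p satisfies 0 ≤ τ_p ≤ 0.36. -/
/-- For every real `p > 1`, the unique `τ_p ∈ [0,1]` with
`2 * (1 - τ_p) ^ p = 1 + τ_p ^ p` satisfies `0 ≤ τ_p ≤ 0.36`. -/
theorem tau_p_le_036 (p τ : ℝ) (hp : 1 < p)
    (hτ : 0 ≤ τ ∧ τ ≤ 1 ∧ 2 * (1 - τ) ^ p = 1 + τ ^ p) :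
    0 ≤ τ ∧ τ ≤ 0.36 := by
  obtain ⟨h0, h1, h⟩ := hτ
  have hconv := (convexOn_rpow hp.le).2 (Set.mem_Ici.2 zero_le_one) (Set.mem_Ici.2 h0)
    (by norm_num : (0 : ℝ) ≤ 1 / 2) (by norm_num : (0 : ℝ) ≤ 1 / 2) (by norm_num)
  simp only [smul_eq_mul, Real.one_rpow] at hconv
  have hle : 1 / 2 * 1 + 1 / 2 * τ ≤ 1 - τ :=
    (Real.rpow_le_rpow_iff (by positivity) (by linarith) (by linarith)).1
      (by linarith : (1 / 2 * 1 + 1 / 2 * τ) ^ p ≤ (1 - τ) ^ p)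
  exact ⟨h0, by norm_num; linarith⟩
end

section
/- For every real p > 1, the lattice Λ_p^{(0)} spanned over ℤ by (1, 0) and (1/2, σ_p/2), with σ_p = (2^p − 1)^{1/p}, is admissible for D_p: every nonzero point (x, y) ∈ Λ_p^{(0)} satisfies |x|^p + |y|^p ≥ 1. -/
noncomputable section

/-- `σ_p = (2^p - 1)^(1/p)`. -/
def sigmaP (p : ℝ) : ℝ := (2 ^ p - 1) ^ (1 / p)

/-- The lattice (ℤ-span) generated by two vectors `v, w ∈ ℝ²`. -/
def latticePts (v w : ℝ × ℝ) : Set (ℝ × ℝ) :=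
  {x | ∃ m n : ℤ, x = (m : ℝ) • v + (n : ℝ) • w}

/-- The lattice `Λ_p⁽⁰⁾` with ℤ-basis `(1,0)` and `(1/2, σ_p/2)`. -/
def Lambda0 (p : ℝ) : Set (ℝ × ℝ) := latticePts (1, 0) (1 / 2, sigmaP p / 2)

theorem sigmaP_rpow (p : ℝ) (hp : 1 < p) : sigmaP p ^ p = 2 ^ p - 1 := by
  have h : (1 : ℝ) ≤ 2 ^ p := Real.one_le_rpow (by norm_num) (by linarith)
  rw [sigmaP, ← Real.rpow_mul (by linarith), one_div_mul_cancel (by linarith), Real.rpow_one]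

theorem one_le_sigmaP (p : ℝ) (hp : 1 < p) : 1 ≤ sigmaP p := by
  have h : (2 : ℝ) ^ (1 : ℝ) ≤ 2 ^ p := Real.rpow_le_rpow_of_exponent_le (by norm_num) hp.le
  rw [Real.rpow_one] at h
  exact Real.one_le_rpow (by linarith) (by positivity)

theorem one_le_abs_intCast {k : ℤ} (hk : k ≠ 0) : (1 : ℝ) ≤ |(k : ℝ)| := by
  exact_mod_cast Int.one_le_abs hk

/-- For every `p > 1`, the lattice `Λ_p⁽⁰⁾` is admissible for
`D_p = {(x,y) : |x|^p + |y|^p < 1}`: every nonzero lattice point `(x,y)`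
satisfies `|x|^p + |y|^p ≥ 1`. -/
theorem lambda0_admissible (p : ℝ) (hp : 1 < p) :
    ∀ x ∈ Lambda0 p, x ≠ 0 → 1 ≤ |x.1| ^ p + |x.2| ^ p := by
  have hp0 : 0 ≤ p := by linarith
  have hσ := one_le_sigmaP p hp
  rintro _ ⟨m, n, rfl⟩ hne
  simp only [Prod.smul_mk, smul_eq_mul, Prod.mk_add_mk, mul_one, mul_zero, zero_add]
  have hx0 := Real.rpow_nonneg (abs_nonneg ((m : ℝ) + n * (1 / 2))) p
  have hy0 := Real.rpow_nonneg (abs_nonneg ((n : ℝ) * (sigmaP p / 2))) p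
  rcases Int.even_or_odd n with ⟨k, rfl⟩ | hodd
  · rcases eq_or_ne k 0 with rfl | hk
    · have hm : m ≠ 0 := by
        rintro rfl
        exact hne (by simp)
      have hx : 1 ≤ |(m : ℝ) + ((0 + 0 : ℤ) : ℝ) * (1 / 2)| := by
        simpa using one_le_abs_intCast hm
      linarith [Real.one_le_rpow hx hp0]
    · have hy : 1 ≤ |((k + k : ℤ) : ℝ) * (sigmaP p / 2)| := by
        rw [show ((k + k : ℤ) : ℝ) * (sigmaP p / 2) = k * sigmaP p by push_cast; ring, abs_mul]
        exact one_le_mul_of_one_le_of_one_le (one_le_abs_intCast hk) (hσ.trans (le_abs_self _))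
      linarith [Real.one_le_rpow hy hp0]
  · have hx : 1 / 2 ≤ |(m : ℝ) + n * (1 / 2)| := by
      have h := one_le_abs_intCast (k := 2 * m + n) (by rcases hodd with ⟨k, rfl⟩; omega)
      rw [show (m : ℝ) + n * (1 / 2) = ((2 * m + n : ℤ) : ℝ) * (1 / 2) by push_cast; ring,
        abs_mul, abs_of_pos (by norm_num : (0 : ℝ) < 1 / 2)]
      linarith
    have hy : sigmaP p / 2 ≤ |(n : ℝ) * (sigmaP p / 2)| := by
      have h := one_le_abs_intCast (k := n) (by rcases hodd with ⟨k, rfl⟩; omega)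
      rw [abs_mul, abs_of_nonneg (by linarith : 0 ≤ sigmaP p / 2)]
      exact le_mul_of_one_le_left (by linarith) h
    have hpos : (0 : ℝ) < 2 ^ p := by positivity
    calc (1 : ℝ) = (1 / 2) ^ p + (sigmaP p / 2) ^ p := by
          rw [Real.div_rpow (by norm_num) (by norm_num), Real.div_rpow (by linarith) (by norm_num),
            sigmaP_rpow p hp, Real.one_rpow]
          field_simp
          ring
      _ ≤ _ := add_le_add (Real.rpow_le_rpow (by norm_num) hx hp0)
          (Real.rpow_le_rpow (by linarith) hy hp0)
end
end
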